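/- Let q be a prime power and let H be a geometry over GF(q) with critical exponent c ≥ 1. Then for every real ε > 0 there is an integer R such that for all n > R, ex_q(H; n) < (1 - q^{1-c} + ε)·(q^n-1)/(q-1). -/

import Mathlib

/-- Containment of geometries: `H`, a set of points of `PG(m-1,q)`, is contained in a set
`M` of points of `PG(n-1,q)` if some injective linear map `F^m → F^n` maps `H` into `M`. -/
def PGContains (F : Type) [Field F] (m n : ℕ)
    (H : Set (Projectivization F (Fin m → F)))
    (M : Set (Projectivization F (Fin n → F))) : Prop :=
  ∃ (f : (Fin m → F) →ₗ[F] (Fin n → F)) (hf : Function.Injective f),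
    ∀ x ∈ H, Projectivization.map f hf x ∈ M

/-- The rank of a set of points: the dimension of its linear span. -/
noncomputable def pgRank (F : Type) [Field F] (n : ℕ)
    (G : Set (Projectivization F (Fin n → F))) : ℕ :=
  Module.finrank F ↥(⨆ x ∈ G, x.submodule)

/-- The flat determined by a subspace `W`: all projective points lying in `W`. -/
def pgFlat (F : Type) [Field F] (n : ℕ) (W : Submodule F (Fin n → F)) :
    Set (Projectivization F (Fin n → F)) :=
  {x | x.submodule ≤ W}

/-- The standard rank-`k` subspace of `F^m`: vectors vanishing on coordinates `≥ k`. -/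
def stdSubspace (F : Type) [Field F] (m k : ℕ) : Submodule F (Fin m → F) :=
  LinearMap.ker (LinearMap.funLeft F F (fun i : {i : Fin m // k ≤ (i : ℕ)} => (i : Fin m)))

/-- `G(m-1,q,c)`: the points of `PG(m-1,q)` outside a rank-`(m-c)` flat. -/
def pgDel (F : Type) [Field F] (m c : ℕ) : Set (Projectivization F (Fin m → F)) :=
  {x | ¬ x.submodule ≤ stdSubspace F m (m - c)}

/-- `ex_q(H; n)`: the maximum size of a set of points of `PG(n-1,q)` not containing `H`. -/
noncomputable def pgEx (F : Type) [Field F] (m : ℕ)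
    (H : Set (Projectivization F (Fin m → F))) (n : ℕ) : ℕ :=
  sSup {k | ∃ M : Set (Projectivization F (Fin n → F)),
    ¬ PGContains F m n H M ∧ M.ncard = k}

/-- The critical exponent of a geometry `H`: the least `c` such that `H` is contained in
`G(r-1,q,c)`, where `r` is the rank of `H`. -/
noncomputable def critExp (F : Type) [Field F] (m : ℕ)
    (H : Set (Projectivization F (Fin m → F))) : ℕ :=
  sInf {c | PGContains F m (pgRank F m H) H (pgDel F (pgRank F m H) c)}

open scoped BigOperators

namespace Combinatorics

/-- The uniform density of a set in a finite type. -/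
noncomputable def density {X : Type} [Fintype X] (A : Set X) : ℝ :=
  𝔼 x, A.indicator (fun _ => (1 : ℝ)) x

lemma expect_prod {X Y : Type} [Fintype X] [Fintype Y] (f : X × Y → ℝ) :
    𝔼 p, f p = 𝔼 x, 𝔼 y, f (x, y) := by
  rw [← Finset.univ_product_univ, Finset.expect_product]

lemma density_nonneg {X : Type} [Fintype X] (A : Set X) : 0 ≤ density A :=
  Finset.expect_nonneg fun _ _ => Set.indicator_nonneg (fun _ _ => zero_le_one) _

lemma density_le_one {X : Type} [Fintype X] [Nonempty X] (A : Set X) : density A ≤ 1 :=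
  Finset.expect_le Finset.univ_nonempty fun _ _ => Set.indicator_le_self' (by simp) _

lemma density_mono {X : Type} [Fintype X] {A B : Set X} (h : A ⊆ B) : density A ≤ density B :=
  Finset.expect_le_expect fun _ _ =>
    Set.indicator_le_indicator_of_subset h (fun _ => zero_le_one) _

lemma nonempty_of_density_pos {X : Type} [Fintype X] {A : Set X} (h : 0 < density A) :
    A.Nonempty := by
  by_contra hA
  rw [Set.not_nonempty_iff_eq_empty] at hA
  simp [density, hA] at h

lemma density_equiv {X Y : Type} [Fintype X] [Fintype Y] (e : X ≃ Y) (A : Set Y) :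
    density (e ⁻¹' A) = density A :=
  Fintype.expect_equiv e _ _ fun _ => rfl

lemma density_eq_ncard_div {X : Type} [Fintype X] (A : Set X) :
    density A = (A.ncard : ℝ) / Fintype.card X := by
  classical
  rw [density, Fintype.expect_eq_sum_div_card, Set.ncard_eq_toFinset_card']
  simp only [Set.indicator_apply, Finset.sum_boole]
  congr 3
  ext x
  simp

namespace Subspace

variable {α ι ι' η θ : Type}

/-- The composition of two combinatorial subspaces. -/
def comp (V : Subspace η α ι) (W : Subspace θ α η) : Subspace θ α ι where
  idxFun i := (V.idxFun i).elim Sum.inl W.idxFun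
  proper e := by
    obtain ⟨j, hj⟩ := W.proper e
    obtain ⟨i, hi⟩ := V.proper j
    exact ⟨i, by simp [hi, hj]⟩

lemma comp_apply (V : Subspace η α ι) (W : Subspace θ α η) (y : θ → α) :
    V.comp W y = V (W y) := by
  ext i
  cases h : V.idxFun i <;> simp [coe_apply, comp, h]

/-- The subspace obtained by fixing the coordinates in the first block. -/
def slice (w : ι → α) : Subspace ι' α (ι ⊕ ι') where
  idxFun := Sum.elim (Sum.inl ∘ w) Sum.inr
  proper e := ⟨Sum.inr e, rfl⟩

lemma slice_apply (w : ι → α) (z : ι' → α) : slice w z = Sum.elim w z := by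
  ext (i | i) <;> simp [coe_apply, slice]

/-- The full subspace, with its coordinates relabelled. -/
def ofEquiv (e : ι ≃ ι') : Subspace ι' α ι where
  idxFun i := Sum.inr (e i)
  proper j := ⟨e.symm j, by simp⟩

lemma ofEquiv_apply (e : ι ≃ ι') (y : ι' → α) : ofEquiv e y = y ∘ e := by
  ext i; simp [coe_apply, ofEquiv]

/-- The product of a subspace and a point. -/
def prodPoint (V : Subspace η α ι) (z : ι' → α) : Subspace η α (ι ⊕ ι') where
  idxFun := Sum.elim V.idxFun (Sum.inl ∘ z)
  proper e := (V.proper e).elim fun i hi => ⟨Sum.inl i, hi⟩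

lemma prodPoint_apply (V : Subspace η α ι) (z : ι' → α) (y : η → α) :
    V.prodPoint z y = Sum.elim (V y) z := by
  ext (i | i) <;> simp [coe_apply, prodPoint]

/-- The product of two subspaces. -/
def prod (V : Subspace η α ι) (W : Subspace θ α ι') : Subspace (η ⊕ θ) α (ι ⊕ ι') where
  idxFun := Sum.elim (fun i => (V.idxFun i).map id Sum.inl) (fun i => (W.idxFun i).map id Sum.inr)
  proper := by
    rintro (e | e)
    · obtain ⟨i, hi⟩ := V.proper e
      exact ⟨Sum.inl i, by simp [hi]⟩
    · obtain ⟨i, hi⟩ := W.proper e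
      exact ⟨Sum.inr i, by simp [hi]⟩

lemma prod_apply (V : Subspace η α ι) (W : Subspace θ α ι') (y : η ⊕ θ → α) :
    V.prod W y = Sum.elim (V (y ∘ Sum.inl)) (W (y ∘ Sum.inr)) := by
  ext (i | i)
  · cases h : V.idxFun i <;> simp [coe_apply, prod, h]
  · cases h : W.idxFun i <;> simp [coe_apply, prod, h]

instance [Finite α] [Finite ι] [Finite η] : Finite (Subspace η α ι) :=
  Finite.of_injective idxFun fun _ _ h => Subspace.ext h

end Subspace

/-- The density Hales-Jewett property for `η`-dimensional subspaces over the alphabet `α`. -/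
def DensityHJ (α η : Type) [Fintype α] : Prop :=
  ∀ δ : ℝ, 0 < δ → ∃ N : ℕ, ∀ (ι : Type) [Fintype ι] [DecidableEq ι], N ≤ Fintype.card ι →
    ∀ A : Set (ι → α), δ ≤ density A → ∃ V : Subspace η α ι, ∀ y, V y ∈ A

/-- For a class of functions on cubes closed under restriction to subspaces whose means do not
eventually drop below `β`, there is a limiting maximal mean `d`, and near-extremal functions have
mean almost `d` on each slice. -/
lemma exists_limiting_mean {α : Type} [Fintype α] [Nonempty α]
    (C : ∀ ι : Type, ((ι → α) → ℝ) → Prop)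
    (hC : ∀ (ι η : Type) (g : (ι → α) → ℝ) (V : Subspace η α ι), C ι g → C η fun y => g (V y))
    (hle : ∀ (ι : Type) (g : (ι → α) → ℝ) (x : ι → α), C ι g → g x ≤ 1) {β : ℝ}
    (h : ∀ N : ℕ, ∃ (ι : Type) (_ : Fintype ι) (_ : DecidableEq ι) (g : (ι → α) → ℝ),
      N ≤ Fintype.card ι ∧ C ι g ∧ β < 𝔼 x, g x) :
    ∃ d : ℝ, β ≤ d ∧
      (∀ τ : ℝ, 0 < τ → ∃ N : ℕ, ∀ (ι : Type) [Fintype ι] [DecidableEq ι], N ≤ Fintype.card ι →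
        ∀ g : (ι → α) → ℝ, C ι g → 𝔼 x, g x ≤ d + τ) ∧
      ∀ (ι : Type) [Fintype ι] [DecidableEq ι] (τ : ℝ), 0 < τ → ∀ N : ℕ,
        ∃ n : ℕ, N ≤ n ∧ ∃ g : (ι ⊕ Fin n → α) → ℝ, C (ι ⊕ Fin n) g ∧
          ∀ w : ι → α, d - τ ≤ 𝔼 z : Fin n → α, g (Sum.elim w z) := by
  classical
  set S : Set ℝ := {δ | ∃ N : ℕ, ∀ (ι : Type) [Fintype ι] [DecidableEq ι], N ≤ Fintype.card ι →
        ∀ g : (ι → α) → ℝ, C ι g → 𝔼 x, g x ≤ δ} with hS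
  have h1 : (1 : ℝ) ∈ S := ⟨0, fun ι _ _ _ g hg =>
    Finset.expect_le Finset.univ_nonempty fun x _ => hle ι g x hg⟩
  have hβ : β ∈ lowerBounds S := by
    rintro δ ⟨N, hN⟩
    obtain ⟨ι, _, _, g, hι, hg, hlt⟩ := h N
    exact (hlt.trans_le (hN ι hι g hg)).le
  have hup : ∀ τ : ℝ, 0 < τ → ∃ N : ℕ, ∀ (ι : Type) [Fintype ι] [DecidableEq ι],
      N ≤ Fintype.card ι → ∀ g : (ι → α) → ℝ, C ι g → 𝔼 x, g x ≤ sInf S + τ := by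
    intro τ hτ
    obtain ⟨δ, ⟨N, hN⟩, hδ⟩ := exists_lt_of_csInf_lt ⟨1, h1⟩ (lt_add_of_pos_right (sInf S) hτ)
    exact ⟨N, fun ι _ _ hι g hg => (hN ι hι g hg).trans hδ.le⟩
  refine ⟨sInf S, le_csInf ⟨1, h1⟩ hβ, hup, fun ι₁ _ _ τ hτ N => ?_⟩
  set K : ℝ := (Fintype.card (ι₁ → α) : ℝ) with hK
  have hK1 : 1 ≤ K := by
    rw [hK]; exact_mod_cast Fintype.card_pos
  have hτ' : 0 < τ / (2 * K) := by positivity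
  obtain ⟨N₁, hN₁⟩ := hup _ hτ'
  have hlow : sInf S - τ / (2 * K) ∉ S := fun hmem =>
    absurd (csInf_le ⟨β, hβ⟩ hmem) (by linarith)
  have : ∃ (ι : Type) (_ : Fintype ι) (_ : DecidableEq ι), max N N₁ + Fintype.card ι₁ ≤
      Fintype.card ι ∧ ∃ g : (ι → α) → ℝ, C ι g ∧ sInf S - τ / (2 * K) < 𝔼 x, g x := by
    by_contra! hcon
    exact hlow ⟨_, fun ι _ _ hι g hg => hcon ι _ _ hι g hg⟩
  obtain ⟨ι, _, _, hι, g, hg, hgm⟩ := this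
  obtain ⟨n, hn⟩ := Nat.exists_eq_add_of_le (le_trans (Nat.le_add_left _ _) hι)
  have hnN : max N N₁ ≤ n := by omega
  let e : ι ≃ ι₁ ⊕ Fin n := Fintype.equivOfCardEq (by simp [hn])
  set g' : (ι₁ ⊕ Fin n → α) → ℝ := fun y => g (Subspace.ofEquiv e y) with hg'
  have hg'C : C _ g' := hC _ _ _ _ hg
  have hslice : ∀ w : ι₁ → α, 𝔼 z : Fin n → α, g' (Sum.elim w z) ≤ sInf S + τ / (2 * K) := by
    intro w
    have := hN₁ (Fin n) (by simpa using (le_max_right _ _).trans hnN) _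
      (hC _ _ _ (Subspace.slice w) hg'C)
    simpa only [Subspace.slice_apply] using this
  have hmean : 𝔼 x, g x = 𝔼 w : ι₁ → α, 𝔼 z : Fin n → α, g' (Sum.elim w z) := by
    rw [← expect_prod (fun p : (ι₁ → α) × (Fin n → α) => g' (Sum.elim p.1 p.2))]
    refine Fintype.expect_equiv ((e.arrowCongr (Equiv.refl α)).trans
      (Equiv.sumArrowEquivProdArrow _ _ _)) _ _ fun x => ?_
    simp only [hg', Subspace.ofEquiv_apply]
    congr 1
    ext i
    simp only [Function.comp_apply, Equiv.trans_apply, Equiv.sumArrowEquivProdArrow]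
    rcases hi : e i with j | j <;> simp [← hi, Equiv.arrowCongr]
  refine ⟨n, (le_max_left _ _).trans hnN, g', hg'C, fun w => ?_⟩
  rw [hmean, Fintype.expect_eq_sum_div_card, lt_div_iff₀ (by positivity), ← hK,
    ← Finset.add_sum_erase _ _ (Finset.mem_univ w)] at hgm
  have hrest : ∑ v ∈ Finset.univ.erase w, 𝔼 z : Fin n → α, g' (Sum.elim v z) ≤
      (K - 1) * (sInf S + τ / (2 * K)) := by
    refine (Finset.sum_le_card_nsmul _ _ _ fun v _ => hslice v).trans_eq ?_
    rw [nsmul_eq_mul, Finset.card_erase_of_mem (Finset.mem_univ w), Finset.card_univ,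
      Nat.cast_sub Fintype.card_pos, ← hK, Nat.cast_one]
  have h2 : τ / (2 * K) * (2 * K) = τ := by field_simp
  nlinarith

/-- If events indexed by a cube have average density at least `δ`, then the events of some subspace
hold simultaneously with density bounded below. -/
lemma DensityHJ.exists_common {κ η : Type} [Fintype κ] [Finite η] (hκ : DensityHJ κ η)
    {δ : ℝ} (hδ : 0 < δ) :
    ∃ N : ℕ, ∀ (ι : Type) [Fintype ι] [DecidableEq ι], N ≤ Fintype.card ι → ∃ c : ℝ, 0 < c ∧
      ∀ (Ω : Type) [Fintype Ω] [Nonempty Ω] (B : (ι → κ) → Set Ω), δ ≤ 𝔼 w, density (B w) →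
        ∃ V : Subspace η κ ι, c ≤ density {ω | ∀ y, ω ∈ B (V y)} := by
  classical
  obtain ⟨N, hN⟩ := hκ (δ / 2) (by linarith)
  refine ⟨N, fun ι _ _ hι => ?_⟩
  have : Fintype (Subspace η κ ι) := Fintype.ofFinite _
  refine ⟨δ / 2 / (Fintype.card (Subspace η κ ι) + 1), by positivity, fun Ω _ _ B hB => ?_⟩
  set G : Set Ω := {ω | δ / 2 ≤ density {w | ω ∈ B w}} with hG
  have hGd : δ / 2 ≤ density G := by
    have hswap : 𝔼 w, density (B w) = 𝔼 ω, density {w | ω ∈ B w} := by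
      unfold density
      rw [Finset.expect_comm]
      rfl
    have hle : 𝔼 ω, density {w | ω ∈ B w} ≤ 𝔼 ω, (G.indicator (fun _ => (1 : ℝ)) ω + δ / 2) := by
      refine Finset.expect_le_expect fun ω _ => ?_
      by_cases hω : ω ∈ G
      · have : Nonempty (ι → κ) := by
          by_contra hne
          rw [not_nonempty_iff] at hne
          simp at hB
          linarith
        simp only [hω, Set.indicator_of_mem]
        linarith [density_le_one {w | ω ∈ B w}]
      · simp only [hω, not_false_iff, Set.indicator_of_notMem]
        have := not_le.1 (show ¬ δ / 2 ≤ density {w | ω ∈ B w} from hω)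
        linarith
    rw [Finset.expect_add_distrib, Fintype.expect_const] at hle
    rw [hswap] at hB
    have : density G = 𝔼 ω, G.indicator (fun _ => (1 : ℝ)) ω := rfl
    linarith
  have hsum : density G ≤ ∑ V : Subspace η κ ι, density {ω | ∀ y, ω ∈ B (V y)} := by
    unfold density
    rw [← Finset.expect_sum_comm]
    refine Finset.expect_le_expect fun ω _ => ?_
    have hnn : ∀ V : Subspace η κ ι,
        0 ≤ Set.indicator {ω | ∀ y, ω ∈ B (V y)} (fun _ => (1 : ℝ)) ω :=
      fun V => Set.indicator_nonneg (fun _ _ => zero_le_one) _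
    by_cases hω : ω ∈ G
    · obtain ⟨V, hV⟩ := hN ι hι _ hω
      refine le_trans ?_ (Finset.single_le_sum (fun V _ => hnn V) (Finset.mem_univ V))
      rw [Set.indicator_of_mem hω, Set.indicator_of_mem (by exact hV)]
    · rw [Set.indicator_of_notMem hω]
      exact Finset.sum_nonneg fun V _ => hnn V
  by_contra! hcon
  have := Finset.sum_le_card_nsmul Finset.univ _ _ fun V _ => (hcon V).le
  rw [nsmul_eq_mul, Finset.card_univ] at this
  have h3 : (Fintype.card (Subspace η κ ι) : ℝ) * (δ / 2 / (Fintype.card (Subspace η κ ι) + 1))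
      < δ / 2 := by
    rw [mul_div_assoc', div_lt_iff₀ (by positivity)]
    nlinarith
  linarith

/-- Lines in dense sets yield subspaces of arbitrary dimension in dense sets. -/
lemma DensityHJ.of_unit {κ : Type} [Fintype κ] (hκ : DensityHJ κ Unit) (η : Type) [Finite η] :
    DensityHJ κ η := by
  induction η using Finite.induction_empty_option with
  | of_equiv e h =>
    intro δ hδ
    obtain ⟨N, hN⟩ := h δ hδ
    refine ⟨N, fun ι _ _ hι A hA => ?_⟩
    obtain ⟨V, hV⟩ := hN ι hι A hA
    refine ⟨V.comp (Subspace.ofEquiv e), fun y => ?_⟩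
    rw [Subspace.comp_apply]
    exact hV _
  | h_empty =>
    refine fun δ hδ => ⟨0, fun ι _ _ _ A hA => ?_⟩
    obtain ⟨x, hx⟩ := nonempty_of_density_pos (hδ.trans_le hA)
    exact ⟨⟨fun i => Sum.inl (x i), fun e => e.elim⟩, fun y => hx⟩
  | @h_option η _ h =>
    intro δ hδ
    obtain ⟨N₁, hN₁⟩ := h.exists_common hδ
    obtain ⟨c, hc, hV⟩ := hN₁ (Fin N₁) (by simp)
    obtain ⟨N₂, hN₂⟩ := hκ c hc
    refine ⟨N₁ + N₂, fun ι _ _ hι A hA => ?_⟩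
    have hne : Nonempty (ι → κ) := (nonempty_of_density_pos (hδ.trans_le hA)).nonempty
    obtain ⟨n, hn⟩ := Nat.exists_eq_add_of_le ((Nat.le_add_right _ _).trans hι)
    let e : Fin N₁ ⊕ Fin n ≃ ι := Fintype.equivOfCardEq (by simp [hn])
    have : Nonempty (Fin n → κ) := hne.map fun x j => x (e (Sum.inr j))
    obtain ⟨V, hV⟩ := hV (Fin n → κ) (fun w => {z | Sum.elim w z ∘ e.symm ∈ A}) (by
      refine hA.trans_eq ?_
      unfold density
      rw [← expect_prod (fun p : (Fin N₁ → κ) × (Fin n → κ) =>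
        Set.indicator {z | Sum.elim p.1 z ∘ e.symm ∈ A} (fun _ => (1 : ℝ)) p.2)]
      refine (Fintype.expect_equiv ((Equiv.sumArrowEquivProdArrow _ _ _).symm.trans
        (e.arrowCongr (Equiv.refl κ))) _ _ fun x => ?_).symm
      rfl)
    obtain ⟨W, hW⟩ := hN₂ (Fin n) (by simp; omega) _ hV
    refine ⟨((Subspace.ofEquiv e.symm).comp (V.prod W)).comp
      (Subspace.ofEquiv (Equiv.optionEquivSumPUnit η).symm), fun y => ?_⟩
    rw [Subspace.comp_apply, Subspace.comp_apply, Subspace.prod_apply, Subspace.ofEquiv_apply]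
    exact hW _ _

/-- A set of words over `Option κ` is insensitive for `i` if membership does not change when
letters `none` and `some i` are exchanged. -/
def Insensitive {κ ι : Type} (i : κ) (E : Set (ι → Option κ)) : Prop :=
  ∀ u v : ι → Option κ, (∀ a, (u a).getD i = (v a).getD i) → u ∈ E → v ∈ E

lemma Insensitive.comap {κ ι η : Type} {i : κ} {E : Set (ι → Option κ)} (hE : Insensitive i E)
    (V : Subspace η (Option κ) ι) : Insensitive i {y | V y ∈ E} := by
  refine fun u v huv => hE _ _ fun a => ?_
  cases h : V.idxFun a <;> simp [Subspace.coe_apply, h, huv]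

lemma Insensitive.compl {κ ι : Type} {i : κ} {E : Set (ι → Option κ)} (hE : Insensitive i E) :
    Insensitive i Eᶜ :=
  fun u v huv hu hv => hu (hE v u (fun a => (huv a).symm) hv)

lemma Insensitive.diff {κ ι : Type} {i : κ} {E F : Set (ι → Option κ)} (hE : Insensitive i E)
    (hF : Insensitive i F) : Insensitive i (E \ F) :=
  fun u v huv hu => ⟨hE u v huv hu.1, hF.compl u v huv hu.2⟩

lemma insensitive_univ {κ ι : Type} (i : κ) : Insensitive i (Set.univ : Set (ι → Option κ)) :=
  fun _ _ _ _ => trivial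

/-- A subspace over `κ`, regarded as a subspace over `Option κ`. -/
def Subspace.withOption {κ ι η : Type} (V : Subspace η κ ι) : Subspace η (Option κ) ι where
  idxFun i := (V.idxFun i).map some id
  proper e := (V.proper e).imp fun i hi => by simp [hi]

/-- A function with large integral over an insensitive set has large mean on a subspace contained in
that set. -/
lemma exists_subspace_of_insensitive {κ η : Type} [Fintype κ] [Nonempty κ] [Fintype η]
    [DecidableEq η] (hκ : DensityHJ κ η) (i : κ) {β : ℝ} (hβ : 0 < β) :
    ∃ N : ℕ, ∀ (ι : Type) [Fintype ι] [DecidableEq ι], N ≤ Fintype.card ι →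
      ∀ (f : (ι → Option κ) → ℝ) (E : Set (ι → Option κ)), (∀ x, f x ≤ 1) → Insensitive i E →
        β ≤ 𝔼 x, E.indicator f x →
        ∃ V : Subspace η (Option κ) ι, (∀ y, V y ∈ E) ∧ β / 4 ≤ 𝔼 y, f (V y) := by
  by_contra! hcon
  let C : ∀ ι : Type, ((ι → Option κ) → ℝ) → Prop := fun ι g =>
    ∃ (f : (ι → Option κ) → ℝ) (E : Set (ι → Option κ)), (∀ x, f x ≤ 1) ∧ Insensitive i E ∧
      (∀ V : Subspace η (Option κ) ι, (∀ y, V y ∈ E) → 𝔼 y, f (V y) < β / 4) ∧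
      g = E.indicator fun x => f x - β / 2
  have hC : ∀ (ι θ : Type) (g : (ι → Option κ) → ℝ) (V : Subspace θ (Option κ) ι),
      C ι g → C θ fun y => g (V y) := by
    rintro ι θ g V ⟨f, E, hf, hE, hno, rfl⟩
    refine ⟨fun y => f (V y), {y | V y ∈ E}, fun y => hf _, hE.comap V, fun W hW => ?_, rfl⟩
    simpa only [Subspace.comp_apply] using
      hno (V.comp W) fun y => by rw [Subspace.comp_apply]; exact hW y
  have hle : ∀ (ι : Type) (g : (ι → Option κ) → ℝ) (x : ι → Option κ), C ι g → g x ≤ 1 := by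
    rintro ι g x ⟨f, E, hf, hE, hno, rfl⟩
    by_cases hx : x ∈ E
    · rw [Set.indicator_of_mem hx]; linarith [hf x]
    · rw [Set.indicator_of_notMem hx]; exact zero_le_one
  obtain ⟨d, hd, hup, hlow⟩ := exists_limiting_mean C hC hle (β := β / 4) (by
    intro N
    obtain ⟨ι, _, _, hι, f, E, hf, hE, hfE, hno⟩ := hcon N
    refine ⟨ι, inferInstance, inferInstance, _, hι, ⟨f, E, hf, hE, hno, rfl⟩, ?_⟩
    have : 𝔼 x, E.indicator f x ≤ 𝔼 x, (E.indicator (fun x => f x - β / 2) x + β / 2) := by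
      refine Finset.expect_le_expect fun x _ => ?_
      by_cases hx : x ∈ E
      · simp [hx]
      · simp [hx]; positivity
    rw [Finset.expect_add_distrib, Fintype.expect_const] at this
    linarith)
  have hd0 : 0 < d := by linarith
  obtain ⟨N, hN⟩ := hκ.exists_common (half_pos hd0)
  obtain ⟨c, hc, hcommon⟩ := hN (Fin N) (by simp)
  obtain ⟨τ, hτ, hτd, hτc⟩ : ∃ τ : ℝ, 0 < τ ∧ τ ≤ d / 2 ∧ 2 * τ < β / 4 * c :=
    ⟨min (d / 2) (β / 16 * c), by positivity, min_le_left _ _, by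
      have := min_le_right (d / 2) (β / 16 * c)
      have : 0 < β * c := by positivity
      linarith⟩
  obtain ⟨N', hN'⟩ := hup τ hτ
  obtain ⟨n, hn, g, ⟨f, E, hf, hE, hno, rfl⟩, hg⟩ := hlow (Fin N) τ hτ N'
  obtain ⟨V, hV⟩ := hcommon (Fin n → Option κ) (fun w => {z | Sum.elim (some ∘ w) z ∈ E}) (by
    refine Finset.le_expect Finset.univ_nonempty fun w _ => ?_
    have : 𝔼 z : Fin n → Option κ, E.indicator (fun x => f x - β / 2) (Sum.elim (some ∘ w) z) ≤
        density {z | Sum.elim (some ∘ w) z ∈ E} := by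
      refine Finset.expect_le_expect fun z _ => ?_
      by_cases hz : Sum.elim (some ∘ w) z ∈ E
      · rw [Set.indicator_of_mem hz, Set.indicator_of_mem (by exact hz)]
        linarith [hf (Sum.elim (some ∘ w) z)]
      · rw [Set.indicator_of_notMem hz, Set.indicator_of_notMem (by exact hz)]
    linarith [hg (some ∘ w)])
  set F : Set (Fin n → Option κ) := {z | ∀ y, Sum.elim (some ∘ V y) z ∈ E} with hF
  change c ≤ density F at hV
  have hFins : Insensitive i F := fun u v huv hu y => hE _ _ (by
    rintro (a | a)
    · rfl
    · exact huv a) (hu y)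
  set W := V.withOption with hW
  have hWE : ∀ z ∈ F, ∀ y, Sum.elim (W y) z ∈ E := fun z hz y =>
    hE _ _ (by
      rintro (a | a)
      · cases h : V.idxFun a <;> simp [Subspace.coe_apply, Subspace.withOption, hW, h]
      · rfl) (hz fun a => (y a).getD i)
  -- Removing the product of the subspace with `F` increases the integral.
  have hremove : ∀ y : η → Option κ, 𝔼 z : Fin n → Option κ,
      ({z | Sum.elim (W y) z ∈ E} \ F).indicator (fun z => f (Sum.elim (W y) z) - β / 2) z ≤
        d + τ := by
    intro y
    refine hN' (Fin n) (by simpa using hn) _ ⟨fun z => f (Sum.elim (W y) z), _, fun z => hf _,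
      ?_, fun U hU => ?_, rfl⟩
    · refine Insensitive.diff ?_ hFins
      simpa only [Subspace.slice_apply] using hE.comap (Subspace.slice (W y))
    · simpa only [Subspace.comp_apply, Subspace.slice_apply] using
        hno ((Subspace.slice (W y)).comp U) fun x => by
          rw [Subspace.comp_apply, Subspace.slice_apply]; exact (hU x).1
  have hsplit : ∀ (y : η → Option κ) (z : Fin n → Option κ),
      E.indicator (fun x => f x - β / 2) (Sum.elim (W y) z) =
      ({z | Sum.elim (W y) z ∈ E} \ F).indicator (fun z => f (Sum.elim (W y) z) - β / 2) z +
      F.indicator (fun z => f (Sum.elim (W y) z) - β / 2) z := by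
    intro y z
    by_cases hz : z ∈ F
    · simp [hz, hWE z hz y]
    · by_cases hzE : Sum.elim (W y) z ∈ E <;> simp [hz, hzE]
  have hF' : 𝔼 z : Fin n → Option κ, 𝔼 y : η → Option κ,
      F.indicator (fun z => f (Sum.elim (W y) z) - β / 2) z ≤
      𝔼 z : Fin n → Option κ, F.indicator (fun _ => (1 : ℝ)) z * (-(β / 4)) := by
    refine Finset.expect_le_expect fun z _ => ?_
    by_cases hz : z ∈ F
    · simp only [Set.indicator_of_mem hz, Finset.expect_sub_distrib, Fintype.expect_const]
      have := hno (W.prodPoint z) fun y => by rw [Subspace.prodPoint_apply]; exact hWE z hz y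
      simp only [Subspace.prodPoint_apply] at this
      linarith
    · simp [Set.indicator_of_notMem hz]
  rw [← Finset.expect_mul, Finset.expect_comm] at hF'
  have h1 : d - τ ≤ 𝔼 y : η → Option κ, 𝔼 z : Fin n → Option κ,
      E.indicator (fun x => f x - β / 2) (Sum.elim (W y) z) :=
    Finset.le_expect Finset.univ_nonempty fun y _ => hg _
  simp only [hsplit, Finset.expect_add_distrib] at h1
  have h2 := Finset.expect_le (s := Finset.univ) Finset.univ_nonempty fun y _ => hremove y
  have h3 : c ≤ 𝔼 z, F.indicator (fun _ => (1 : ℝ)) z := hV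
  nlinarith

/-- A function with positive integral over an intersection of insensitive sets has positive mean on
a subspace contained in that intersection. -/
lemma exists_subspace_of_forall_insensitive {κ : Type} [Fintype κ] [Nonempty κ]
    (hκ : ∀ m : ℕ, DensityHJ κ (Fin m)) (s : Finset κ) :
    ∀ (m : ℕ) (β : ℝ), 0 < β →
    ∃ N : ℕ, ∀ (ι : Type) [Fintype ι] [DecidableEq ι], N ≤ Fintype.card ι →
      ∀ (f : (ι → Option κ) → ℝ) (E : κ → Set (ι → Option κ)), (∀ x, f x ≤ 1) →
        (∀ i ∈ s, Insensitive i (E i)) → β ≤ 𝔼 x, (⋂ i ∈ s, E i).indicator f x →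
        ∃ V : Subspace (Fin m) (Option κ) ι, 0 < 𝔼 y, f (V y) := by
  classical
  induction s using Finset.induction_on with
  | empty =>
    intro m β hβ
    obtain ⟨N, hN⟩ := exists_subspace_of_insensitive (hκ m) (Classical.arbitrary κ) hβ
    refine ⟨N, fun ι _ _ hι f E hf _ hfE => ?_⟩
    obtain ⟨V, -, hV⟩ := hN ι hι f Set.univ hf (insensitive_univ _) (by simpa using hfE)
    exact ⟨V, by linarith⟩
  | insert j s hj ih =>
    intro m β hβ
    obtain ⟨N₁, hN₁⟩ := ih m (β / 4) (by linarith)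
    obtain ⟨N, hN⟩ := exists_subspace_of_insensitive (hκ N₁) j hβ
    refine ⟨N, fun ι _ _ hι f E hf hE hfE => ?_⟩
    obtain ⟨V, hV, hVm⟩ := hN ι hι ((⋂ i ∈ s, E i).indicator f) (E j)
      (fun x => Set.indicator_apply_le' (fun _ => hf x) fun _ => zero_le_one)
      (hE j (Finset.mem_insert_self _ _)) (by
        rw [Finset.set_biInter_insert] at hfE
        simpa only [Set.indicator_indicator] using hfE)
    obtain ⟨W, hW⟩ := hN₁ (Fin N₁) (by simp) (fun y => f (V y)) (fun i => {y | V y ∈ E i})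
      (fun y => hf _) (fun i hi => (hE i (Finset.mem_insert_of_mem hi)).comap V) (by
        refine hVm.trans_eq (Finset.expect_congr rfl fun y _ => ?_)
        simp [Set.indicator_apply])
    refine ⟨V.comp W, ?_⟩
    simpa only [Subspace.comp_apply] using hW

/-- If a set has large density relative to the complement of an intersection and meets that
intersection in a small set, then its balanced indicator has large integral over some atom. -/
lemma exists_atom {X κ : Type} [Fintype X] [Nonempty X] [Fintype κ] [DecidableEq κ] (A : Set X)
    (D : κ → Set X) {s γ : ℝ} (hγ : 0 < γ)
    (h : γ ≤ density A - s * (1 - density (⋂ i, D i)) - density (A ∩ ⋂ i, D i)) :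
    ∃ T : Finset κ, γ / 2 ^ Fintype.card κ ≤
      𝔼 x, (⋂ i, if i ∈ T then D i else (D i)ᶜ).indicator
        (fun x => A.indicator (fun _ => (1 : ℝ)) x - s) x := by
  classical
  set f : X → ℝ := fun x => A.indicator (fun _ => (1 : ℝ)) x - s with hf
  by_contra! hcon
  have hpoint : ∀ x, ∑ T ∈ Finset.univ.erase Finset.univ,
      (⋂ i, if i ∈ T then D i else (D i)ᶜ).indicator f x = f x - (⋂ i, D i).indicator f x := by
    intro x
    have hmem : ∀ T : Finset κ, (x ∈ ⋂ i, if i ∈ T then D i else (D i)ᶜ) ↔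
        T = Finset.univ.filter fun i => x ∈ D i := by
      intro T
      rw [Set.mem_iInter, Finset.ext_iff]
      refine forall_congr' fun i => ?_
      by_cases hi : i ∈ T <;> simp [hi]
    have huniv : (⋂ i, D i).indicator f x =
        (⋂ i, if i ∈ (Finset.univ : Finset κ) then D i else (D i)ᶜ).indicator f x := by simp
    rw [huniv, eq_sub_iff_add_eq, Finset.sum_erase_add _ _ (Finset.mem_univ _)]
    simp only [Set.indicator_apply _ f, hmem]
    simp
  have hsum : 𝔼 x, (f x - (⋂ i, D i).indicator f x) ≤
      (Finset.univ.erase (Finset.univ : Finset κ)).card • (γ / 2 ^ Fintype.card κ) := by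
    simp only [← hpoint]
    rw [Finset.expect_sum_comm]
    exact Finset.sum_le_card_nsmul _ _ _ fun T _ => (hcon T).le
  have hcard : ((Finset.univ.erase (Finset.univ : Finset κ)).card : ℝ) < 2 ^ Fintype.card κ := by
    rw [Finset.card_erase_of_mem (Finset.mem_univ _), Finset.card_univ, Fintype.card_finset]
    exact_mod_cast Nat.sub_lt (by positivity) one_pos
  have hpos : 0 < γ / 2 ^ Fintype.card κ := by positivity
  have heq : ∀ x, (⋂ i, D i).indicator f x = (A ∩ ⋂ i, D i).indicator (fun _ => (1 : ℝ)) x -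
      s * (⋂ i, D i).indicator (fun _ => (1 : ℝ)) x := by
    intro x
    by_cases hx : x ∈ ⋂ i, D i <;> by_cases hA : x ∈ A <;> simp [Set.indicator_apply, hx, hA, hf]
  simp only [heq] at hsum
  simp only [hf, Finset.expect_sub_distrib, ← Finset.mul_expect, Fintype.expect_const,
    nsmul_eq_mul] at hsum
  have h2 := mul_lt_mul_of_pos_right hcard hpos
  rw [mul_div_cancel₀ _ (by positivity)] at h2
  change density A - s - (density (A ∩ ⋂ i, D i) - s * density (⋂ i, D i)) ≤ _ at hsum
  linarith

lemma density_forall_ne_none (κ θ : Type) [Fintype κ] [Fintype θ] [DecidableEq θ] :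
    density {u : θ → Option κ | ∀ a, u a ≠ none} =
      ((Fintype.card κ : ℝ) / (Fintype.card κ + 1)) ^ Fintype.card θ := by
  have hrange : {u : θ → Option κ | ∀ a, u a ≠ none} =
      Set.range fun v : θ → κ => fun a => some (v a) := by
    ext u
    simp only [Set.mem_ofPred_eq, Set.mem_range, Option.ne_none_iff_exists]
    refine ⟨fun h => ?_, ?_⟩
    · choose v hv using h
      exact ⟨v, funext hv⟩
    · rintro ⟨v, rfl⟩ a
      exact ⟨v a, rfl⟩
  rw [density_eq_ncard_div, hrange, ← Set.image_univ, Set.ncard_image_of_injective,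
    Set.ncard_univ, Nat.card_eq_fintype_card]
  · simp [div_pow]
  · exact fun v w h => funext fun a => Option.some_injective _ (congrFun h a)

/-- Blowing up a common line yields a subspace on which a set keeps its slice density and which
correlates with the insensitive sets given by the points of the line. -/
lemma exists_subspace_of_line {κ ι μ ν : Type} [Fintype κ] [Fintype ι] [DecidableEq ι]
    [Fintype μ] [DecidableEq μ] [Fintype ν] [DecidableEq ν]
    (V : Subspace Unit κ ι) (A : Set ((ι × μ) ⊕ ν → Option κ)) {c d s : ℝ} (hs : 0 ≤ s)
    (hd : ∀ w : ι × μ → Option κ, d ≤ density {z : ν → Option κ | Sum.elim w z ∈ A})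
    (hc : c ≤ density {x : (ι × μ → Option κ) × (ν → Option κ) | ∀ y,
      Sum.elim (fun t => some ((x.1 t).getD (V y t.1))) x.2 ∈ A}) :
    ∃ (θ : Type) (_ : Fintype θ) (_ : DecidableEq θ) (W : Subspace θ (Option κ) ((ι × μ) ⊕ ν)),
      Fintype.card μ ≤ Fintype.card θ ∧
      d + s * c ≤ density {u | W u ∈ A} +
        s * density (⋂ i : κ, {u : θ → Option κ | W (fun a => some ((u a).getD i)) ∈ A}) := by
  classical
  let p : ι × μ → Prop := fun t => V.idxFun t.1 = Sum.inr ()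
  let Q := ({t // ¬ p t} → Option κ) × (ν → Option κ)
  let W : Q → Subspace {t // p t} (Option κ) ((ι × μ) ⊕ ν) := fun q =>
    { idxFun := Sum.elim
        (fun t => if h : p t then Sum.inr ⟨t, h⟩ else
          Sum.inl ((V.idxFun t.1).elim (fun l => some ((q.1 ⟨t, h⟩).getD l)) fun _ => none))
        (Sum.inl ∘ q.2)
      proper := fun e => ⟨Sum.inl e.1, by simp [e.2]⟩ }
  have hX : d ≤ 𝔼 q : Q, density {u | W q u ∈ A} := by
    unfold density
    rw [expect_prod]
    refine Finset.le_expect Finset.univ_nonempty fun y _ => ?_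
    rw [Finset.expect_comm]
    refine Finset.le_expect Finset.univ_nonempty fun u _ => ?_
    refine (hd fun t => if h : p t then u ⟨t, h⟩ else
      (V.idxFun t.1).elim (fun l => some ((y ⟨t, h⟩).getD l)) fun _ => none).trans_eq ?_
    refine Finset.expect_congr rfl fun z _ => ?_
    have : W (y, z) u = Sum.elim (fun t => if h : p t then u ⟨t, h⟩ else
        (V.idxFun t.1).elim (fun l => some ((y ⟨t, h⟩).getD l)) fun _ => none) z := by
      ext1 (t | b)
      · by_cases h : p t <;> simp [W, Subspace.coe_apply, h]
      · simp [W, Subspace.coe_apply]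
    simp only [Set.indicator_apply, Set.mem_ofPred_eq, this]
  have hY : c ≤ 𝔼 q : Q, density (⋂ i : κ, {u : {t // p t} → Option κ | W q (fun a => some ((u a).getD i)) ∈ A}) := by
    refine hc.trans_eq ?_
    unfold density
    rw [expect_prod, expect_prod, Finset.expect_comm]
    nth_rw 2 [Finset.expect_comm]
    refine Finset.expect_congr rfl fun z _ => ?_
    rw [← expect_prod (fun x : ({t // ¬ p t} → Option κ) × ({t // p t} → Option κ) =>
      (⋂ i : κ, {u : {t // p t} → Option κ | W (x.1, z) (fun a => some ((u a).getD i)) ∈ A}).indicator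
        (fun _ => (1 : ℝ)) x.2)]
    refine Fintype.expect_equiv ((Equiv.piEquivPiSubtypeProd p _).trans (Equiv.prodComm _ _)) _ _
      fun y => ?_
    have : ∀ i : κ, W (fun t => y t.1, z) (fun a => some ((y a.1).getD i)) =
        Sum.elim (fun t => some ((y t).getD (V (fun _ => i) t.1))) z := by
      intro i
      ext1 (t | b)
      · by_cases h : p t
        · have h' : V.idxFun t.1 = Sum.inr () := h
          simp [W, Subspace.coe_apply, h, h']
        · rcases h' : V.idxFun t.1 with l | j
          · simp [W, Subspace.coe_apply, h, h']
          · exact absurd h' h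
      · simp [W, Subspace.coe_apply]
    have hunit : ∀ (P : (Unit → κ) → Prop), (∀ y, P y) ↔ ∀ i, P fun _ => i := fun P =>
      ⟨fun h i => h _, fun h y => h (y ())⟩
    simp only [Set.indicator_apply, Set.mem_ofPred_eq, Set.mem_iInter, Equiv.trans_apply,
      Equiv.piEquivPiSubtypeProd_apply, Equiv.prodComm_apply, Prod.swap_prod_mk, this]
    exact if_congr (hunit _) rfl rfl
  obtain ⟨q, hq⟩ : ∃ q : Q, d + s * c ≤ density {u | W q u ∈ A} +
      s * density (⋂ i : κ, {u : {t // p t} → Option κ | W q (fun a => some ((u a).getD i)) ∈ A}) := by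
    by_contra! hcon
    have h1 : 𝔼 q : Q, (density {u | W q u ∈ A} +
      s * density (⋂ i : κ, {u : {t // p t} → Option κ | W q (fun a => some ((u a).getD i)) ∈ A})) < d + s * c := by
      refine (Finset.expect_lt_expect (g := fun _ => d + s * c) (fun q _ => (hcon q).le)
        ⟨Classical.arbitrary _, Finset.mem_univ _, hcon _⟩).trans_eq (Fintype.expect_const _)
    rw [Finset.expect_add_distrib, ← Finset.mul_expect] at h1
    nlinarith
  obtain ⟨i, hi⟩ := V.proper ()
  refine ⟨{t // p t}, inferInstance, inferInstance, W q, ?_, hq⟩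
  exact Fintype.card_le_of_injective (fun b : μ => ⟨(i, b), hi⟩) fun a b h => by simpa using h

/-- The density Hales-Jewett property passes from an alphabet to one with one more letter. -/
lemma DensityHJ.option {κ : Type} [Fintype κ] [Nonempty κ] [DecidableEq κ]
    (hκ : DensityHJ κ Unit) : DensityHJ (Option κ) Unit := by
  classical
  intro δ hδ
  by_contra! hcon
  let C : ∀ ι : Type, ((ι → Option κ) → ℝ) → Prop := fun ι g =>
    ∃ A : Set (ι → Option κ), (∀ V : Subspace Unit (Option κ) ι, ∃ y, V y ∉ A) ∧
      g = A.indicator fun _ => (1 : ℝ)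
  have hC : ∀ (ι θ : Type) (g : (ι → Option κ) → ℝ) (V : Subspace θ (Option κ) ι),
      C ι g → C θ fun y => g (V y) := by
    rintro ι θ g V ⟨A, hA, rfl⟩
    refine ⟨{y | V y ∈ A}, fun W => ?_, rfl⟩
    obtain ⟨y, hy⟩ := hA (V.comp W)
    exact ⟨y, by rwa [Subspace.comp_apply] at hy⟩
  have hle : ∀ (ι : Type) (g : (ι → Option κ) → ℝ) (x : ι → Option κ), C ι g → g x ≤ 1 := by
    rintro ι g x ⟨A, hA, rfl⟩
    exact Set.indicator_le_self' (by simp) _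
  obtain ⟨d, hd, hup, hlow⟩ := exists_limiting_mean C hC hle (β := δ / 2) (by
    intro N
    obtain ⟨ι, _, _, hι, A, hA, hno⟩ := hcon N
    exact ⟨ι, inferInstance, inferInstance, _, hι, ⟨A, hno, rfl⟩,
      lt_of_lt_of_le (by linarith) hA⟩)
  have hd0 : 0 < d := by linarith
  obtain ⟨N, hN⟩ := hκ.exists_common (half_pos hd0)
  obtain ⟨c, hc, hcommon⟩ := hN (Fin N) (by simp)
  have hdc : 0 < d * c := by positivity
  obtain ⟨τ, hτ, hτc⟩ : ∃ τ : ℝ, 0 < τ ∧ τ = d * c / 8 := ⟨_, by positivity, rfl⟩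
  obtain ⟨N₁, hN₁⟩ := hup τ hτ
  obtain ⟨N₂, hN₂⟩ := exists_subspace_of_forall_insensitive (fun m => hκ.of_unit (Fin m))
    Finset.univ N₁ (d * c / 2 / 2 ^ Fintype.card κ) (by positivity)
  set r : ℝ := (Fintype.card κ : ℝ) / (Fintype.card κ + 1) with hr
  have hr1 : r < 1 := by rw [hr, div_lt_one (by positivity)]; linarith
  have hr0 : 0 ≤ r := by positivity
  obtain ⟨m, hm⟩ := exists_pow_lt_of_lt_one (show 0 < d * c / 4 by positivity) hr1
  obtain ⟨n, -, g, ⟨A, hA, rfl⟩, hslice⟩ := hlow (Fin N × Fin (max N₂ m)) (min τ (d / 2))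
    (by positivity) 0
  replace hslice : ∀ w : Fin N × Fin (max N₂ m) → Option κ,
      d - min τ (d / 2) ≤ density {z : Fin n → Option κ | Sum.elim w z ∈ A} := hslice
  obtain ⟨V, hV⟩ := hcommon ((Fin N × Fin (max N₂ m) → Option κ) × (Fin n → Option κ))
    (fun w => {x | Sum.elim (fun t => some ((x.1 t).getD (w t.1))) x.2 ∈ A}) (by
      refine Finset.le_expect Finset.univ_nonempty fun w _ => ?_
      unfold density
      rw [expect_prod]
      refine Finset.le_expect Finset.univ_nonempty fun y _ => ?_
      refine le_trans ?_ (hslice fun t => some ((y t).getD (w t.1)))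
      linarith [min_le_right τ (d / 2)])
  obtain ⟨θ, _, _, W, hθ, hW⟩ := exists_subspace_of_line V A (s := d + τ) (by positivity) hslice hV
  rw [Fintype.card_fin] at hθ
  set X : Set (θ → Option κ) := {u | W u ∈ A} with hX
  set D : κ → Set (θ → Option κ) := fun i => {u | W (fun a => some ((u a).getD i)) ∈ A} with hD
  have hsmall : density (X ∩ ⋂ i, D i) ≤ d * c / 4 := by
    have hsub : X ∩ ⋂ i, D i ⊆ {u | ∀ a, u a ≠ none} := by
      rintro u ⟨huX, huD⟩ a ha
      rw [Set.mem_iInter] at huD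
      let L : Subspace Unit (Option κ) θ :=
        { idxFun := fun b => (u b).elim (Sum.inr ()) fun i => Sum.inl (some i)
          proper := fun _ => ⟨a, by simp [ha]⟩ }
      obtain ⟨y, hy⟩ := hA (W.comp L)
      refine hy ?_
      rw [Subspace.comp_apply]
      rcases hyi : y () with _ | i
      · suffices h : L y = u by rw [h]; exact huX
        ext1 b
        rcases hb : u b with _ | j <;> simp [Subspace.coe_apply, L, hb, hyi]
      · suffices h : L y = fun a => some ((u a).getD i) by rw [h]; exact huD i
        ext1 b
        rcases hb : u b with _ | j <;> simp [Subspace.coe_apply, L, hb, hyi]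
    refine (density_mono hsub).trans ?_
    rw [density_forall_ne_none]
    exact (pow_le_pow_of_le_one hr0 hr1.le ((le_max_right _ _).trans hθ)).trans hm.le
  obtain ⟨T, hT⟩ := exists_atom X D (s := d + τ) (γ := d * c / 2) (by positivity) (by
    have := min_le_left τ (d / 2)
    have : 0 < τ * c := by positivity
    linarith)
  have hDins : ∀ i, Insensitive i (D i) := by
    intro i u v huv hu
    simpa only [hD, Set.mem_ofPred_eq, huv] using hu
  have hX1 : ∀ x, X.indicator (fun _ => (1 : ℝ)) x - (d + τ) ≤ 1 := by
    intro x
    have : X.indicator (fun _ => (1 : ℝ)) x ≤ 1 := Set.indicator_le_self' (by simp) _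
    linarith
  have hE : ∀ i ∈ Finset.univ, Insensitive i (if i ∈ T then D i else (D i)ᶜ) := by
    intro i _
    split_ifs
    · exact hDins i
    · exact (hDins i).compl
  obtain ⟨U, hU⟩ := hN₂ θ ((le_max_left _ _).trans hθ) _ _ hX1 hE
    (by simpa only [Finset.mem_univ, Set.iInter_true] using hT)
  have hU' := hN₁ (Fin N₁) (by simp) _ (hC _ _ _ (W.comp U) ⟨A, hA, rfl⟩)
  rw [Finset.expect_sub_distrib, Fintype.expect_const] at hU
  simp only [Subspace.comp_apply] at hU'
  exact absurd (lt_of_lt_of_le (sub_pos.1 hU) hU') (lt_irrefl (d + τ))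

/-- The density Hales-Jewett theorem, in its multidimensional form. -/
theorem densityHJ (α : Type) [Fintype α] (η : Type) [Finite η] : DensityHJ α η := by
  classical
  suffices h : ∀ (α : Type) [Finite α] [Fintype α], DensityHJ α Unit from (h α).of_unit η
  clear! α
  intro α _
  induction α using Finite.induction_empty_option with
  | @of_equiv α β e ih =>
    intro _ δ hδ
    have : Fintype α := Fintype.ofEquiv β e.symm
    obtain ⟨N, hN⟩ := ih δ hδ
    refine ⟨N, fun ι _ _ hι A hA => ?_⟩
    obtain ⟨V, hV⟩ := hN ι hι _
      (hA.trans_eq (density_equiv ((Equiv.refl ι).arrowCongr e) A).symm)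
    refine ⟨V.reindex (Equiv.refl _) e (Equiv.refl _), fun y => ?_⟩
    suffices h : V.reindex (Equiv.refl _) e (Equiv.refl _) y = e ∘ V (e.symm ∘ y) by
      rw [h]; exact hV _
    ext i
    simp
  | h_empty =>
    refine fun δ hδ => ⟨1, fun ι _ _ hι A hA => ?_⟩
    obtain ⟨x, -⟩ := nonempty_of_density_pos (hδ.trans_le hA)
    obtain ⟨i⟩ := Fintype.card_pos_iff.1 hι
    exact (x i).elim
  | @h_option κ _ ih =>
    intro inst
    rcases isEmpty_or_nonempty κ with hκ | hκ
    · refine fun δ hδ => ⟨1, fun ι _ _ hι A hA => ?_⟩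
      obtain ⟨x, hx⟩ := nonempty_of_density_pos (hδ.trans_le hA)
      obtain ⟨i⟩ := Fintype.card_pos_iff.1 hι
      let V : Subspace Unit (Option κ) ι := ⟨fun _ => Sum.inr (), fun _ => ⟨i, rfl⟩⟩
      exact ⟨V, fun y => by rwa [Subsingleton.elim (V y) x]⟩
    · have : Fintype κ := Fintype.ofFinite κ
      rw [Subsingleton.elim inst instFintypeOption]
      exact ih.option

lemma density_compl {X : Type} [Fintype X] [Nonempty X] (A : Set X) :
    density Aᶜ = 1 - density A := by
  rw [eq_sub_iff_add_eq]
  unfold density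
  rw [← Finset.expect_add_distrib]
  simp [Set.indicator_compl_add_self_apply]

lemma density_iUnion_le {X κ : Type} [Fintype X] [Fintype κ] (D : κ → Set X) :
    density (⋃ i, D i) ≤ ∑ i, density (D i) := by
  unfold density
  rw [← Finset.expect_sum_comm]
  refine Finset.expect_le_expect fun x _ => ?_
  have hnn : ∀ i ∈ Finset.univ, 0 ≤ (D i).indicator (fun _ => (1 : ℝ)) x :=
    fun i _ => Set.indicator_nonneg (fun _ _ => zero_le_one) _
  by_cases hx : x ∈ ⋃ i, D i
  · obtain ⟨i, hi⟩ := Set.mem_iUnion.1 hx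
    refine le_trans ?_ (Finset.single_le_sum hnn (Finset.mem_univ i))
    rw [Set.indicator_of_mem hx, Set.indicator_of_mem hi]
  · rw [Set.indicator_of_notMem hx]
    exact Finset.sum_nonneg hnn

end Combinatorics

open Combinatorics

/-- Supersaturation for the Bose-Burton theorem: a dense set of vectors closed under nonzero scalars
contains all nonzero combinations of a positive proportion of tuples. -/
lemma pow_le_density_forall_sum_mem {F X : Type} [Field F] [Fintype F] [AddCommGroup X]
    [Module F X] [Fintype X] {A : Set X} (hA : ∀ u : F, u ≠ 0 → ∀ x ∈ A, u • x ∈ A) {δ : ℝ}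
    (hδ : 0 ≤ δ) (j : ℕ) (h : ∀ i < j, (Fintype.card F : ℝ) ^ i * (1 - density A) ≤ 1 - δ) :
    δ ^ j ≤ density {e : Fin j → X | ∀ a : Fin j → F, a ≠ 0 → ∑ i, a i • e i ∈ A} := by
  classical
  induction j with
  | zero =>
    have : {e : Fin 0 → X | ∀ a : Fin 0 → F, a ≠ 0 → ∑ i, a i • e i ∈ A} = Set.univ :=
      Set.eq_univ_of_forall fun e a ha => absurd (Subsingleton.elim a 0) ha
    rw [this]
    simp [density]
  | succ j ih =>
    specialize ih fun i hi => h i (hi.trans j.lt_succ_self)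
    set G := {e : Fin j → X | ∀ a : Fin j → F, a ≠ 0 → ∑ i, a i • e i ∈ A} with hG
    have hstep : ∀ e : Fin j → X,
        δ ≤ density {x | ∀ b : Fin j → F, x + ∑ i, b i • e i ∈ A} := by
      intro e
      have hset : {x | ∀ b : Fin j → F, x + ∑ i, b i • e i ∈ A} =
          (⋃ b : Fin j → F, Equiv.addRight (∑ i, b i • e i) ⁻¹' Aᶜ)ᶜ := by
        ext x; simp
      rw [hset, density_compl]
      have := density_iUnion_le fun b : Fin j → F => Equiv.addRight (∑ i, b i • e i) ⁻¹' Aᶜ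
      simp only [density_equiv, density_compl, Finset.sum_const, Finset.card_univ,
        Fintype.card_fun, Fintype.card_fin, nsmul_eq_mul, Nat.cast_pow] at this
      linarith [h j j.lt_succ_self]
    have hsub : ∀ (x : X) (e : Fin j → X), e ∈ G → (∀ b : Fin j → F, x + ∑ i, b i • e i ∈ A) →
        (Fin.cons x e : Fin (j + 1) → X) ∈
          {e : Fin (j + 1) → X | ∀ a : Fin (j + 1) → F, a ≠ 0 → ∑ i, a i • e i ∈ A} := by
      intro x e he hx a ha
      rw [Fin.sum_univ_succ]
      simp only [Fin.cons_zero, Fin.cons_succ]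
      by_cases h0 : a 0 = 0
      · rw [h0, zero_smul, zero_add]
        refine he (fun i => a i.succ) fun h' => ha ?_
        ext i
        refine Fin.cases h0 (fun i => ?_) i
        exact congrFun h' i
      · convert hA (a 0) h0 _ (hx fun i => (a 0)⁻¹ * a i.succ) using 1
        simp [smul_add, Finset.smul_sum, smul_smul, h0]
    rw [← density_equiv (Fin.consEquiv fun _ => X), pow_succ]
    calc δ ^ j * δ ≤ density G * δ := by gcongr
      _ = 𝔼 e : Fin j → X, G.indicator (fun _ => (1 : ℝ)) e * δ := by
        rw [← Finset.expect_mul]; rfl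
      _ ≤ 𝔼 e : Fin j → X, 𝔼 x : X, (Fin.consEquiv (fun _ => X) ⁻¹'
          {e : Fin (j + 1) → X | ∀ a : Fin (j + 1) → F, a ≠ 0 → ∑ i, a i • e i ∈ A}).indicator
            (fun _ => (1 : ℝ)) (x, e) := by
        refine Finset.expect_le_expect fun e _ => ?_
        by_cases he : e ∈ G
        · rw [Set.indicator_of_mem he, one_mul]
          refine (hstep e).trans (density_mono fun x hx => ?_)
          exact hsub x e he hx
        · rw [Set.indicator_of_notMem he, zero_mul]
          exact density_nonneg _
      _ = _ := by
        rw [Finset.expect_comm]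
        exact (expect_prod _).symm

/-- A dense set of vectors closed under nonzero scalars contains, up to an injective linear map, the
complement of a flat of corank `c`. -/
lemma exists_linearMap_mem_of_density (F : Type) [Field F] [Fintype F] (r c : ℕ) {δ : ℝ}
    (hδ : 0 < δ) :
    ∃ N : ℕ, ∀ n : ℕ, N ≤ n → ∀ A : Set (Fin n → F), 0 ∉ A →
      (∀ u : F, u ≠ 0 → ∀ x ∈ A, u • x ∈ A) →
      (∀ i < c, (Fintype.card F : ℝ) ^ i * (1 - density A) ≤ 1 - δ) →
      ∃ g : (Fin r → F) × (Fin c → F) →ₗ[F] Fin n → F, Function.Injective g ∧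
        ∀ b a, a ≠ 0 → g (b, a) ∈ A := by
  classical
  obtain ⟨N, hN⟩ := densityHJ (Fin c → F) (Fin r) (δ ^ c) (by positivity)
  refine ⟨N, fun n hn A h0 hA hd => ?_⟩
  obtain ⟨V, hV⟩ := hN (Fin n) (by simpa using hn) _
    ((pow_le_density_forall_sum_mem hA hδ.le c hd).trans_eq
      (density_equiv (Equiv.piComm fun _ _ => F) _).symm)
  let g : (Fin r → F) × (Fin c → F) →ₗ[F] Fin n → F :=
    LinearMap.pi fun j => (V.idxFun j).elim
      (fun l => (∑ i, l i • LinearMap.proj i) ∘ₗ LinearMap.snd F _ _)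
      (fun k => LinearMap.proj k ∘ₗ LinearMap.fst F _ _)
  have hg : ∀ b a, a ≠ 0 → g (b, a) ∈ A := by
    intro b a ha
    obtain ⟨i₀, hi₀⟩ := Function.ne_iff.1 ha
    replace hi₀ : a i₀ ≠ 0 := hi₀
    convert hV (fun k => Pi.single i₀ (b k / a i₀)) a ha using 1
    ext j
    rcases hj : V.idxFun j with l | k
    · simp [g, hj, Function.swap, Subspace.coe_apply, mul_comm]
    · simp [g, hj, Function.swap, Subspace.coe_apply, Pi.single_apply, mul_div_cancel₀, hi₀]
  refine ⟨g, (injective_iff_map_eq_zero g).2 ?_, hg⟩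
  rintro ⟨b, a⟩ hba
  have ha : a = 0 := by
    by_contra ha
    exact h0 (hba ▸ hg b a ha)
  have hb : b = 0 := by
    ext k
    obtain ⟨j, hj⟩ := V.proper k
    simpa [g, hj] using congrFun hba j
  rw [ha, hb]; rfl

/-- The cone over a set of points has at least `q - 1` vectors for each point. -/
lemma mul_ncard_le_ncard_cone {F X : Type} [Field F] [Fintype F] [AddCommGroup X] [Module F X]
    [Finite X] (M : Set (Projectivization F X)) :
    (Fintype.card F - 1) * M.ncard ≤
      {v : X | ∃ h : v ≠ 0, Projectivization.mk F v h ∈ M}.ncard := by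
  classical
  have := Fintype.ofFinite M
  have := Fintype.ofFinite {v : X | ∃ h : v ≠ 0, Projectivization.mk F v h ∈ M}
  rw [← Fintype.card_units, Set.ncard_eq_toFinset_card', Set.ncard_eq_toFinset_card',
    Set.toFinset_card, Set.toFinset_card, ← Fintype.card_prod]
  have hne : ∀ p : Fˣ × M, (p.1 : F) • p.2.1.rep ≠ 0 := fun p =>
    smul_ne_zero p.1.ne_zero p.2.1.rep_nonzero
  have hmk : ∀ p : Fˣ × M, Projectivization.mk F _ (hne p) = p.2.1 := by
    intro p
    conv_rhs => rw [← p.2.1.mk_rep]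
    exact (Projectivization.mk_eq_mk_iff' F _ _ _ _).2 ⟨p.1, rfl⟩
  refine Fintype.card_le_of_injective
    (fun p => ⟨(p.1 : F) • p.2.1.rep, hne p, by rw [hmk]; exact p.2.2⟩) fun p p' h => ?_
  have h' : (p.1 : F) • p.2.1.rep = (p'.1 : F) • p'.2.1.rep := congrArg Subtype.val h
  have h2 : p.2 = p'.2 := by
    refine Subtype.ext ?_
    rw [← hmk p, ← hmk p']
    congr 1
  refine Prod.ext (Units.ext ?_) h2
  rw [h2] at h'
  exact smul_left_injective F p'.2.1.rep_nonzero h'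

/-- A large set of points of a projective geometry has a cone of almost the same density. -/
lemma exists_le_density_cone (F : Type) [Field F] [Fintype F] {β ε : ℝ} (hε : 0 < ε) :
    ∃ N : ℕ, ∀ n : ℕ, N ≤ n → ∀ M : Set (Projectivization F (Fin n → F)),
      (β + ε) * (((Fintype.card F : ℝ) ^ n - 1) / ((Fintype.card F : ℝ) - 1)) ≤ M.ncard →
        β ≤ density {v : Fin n → F | ∃ h : v ≠ 0, Projectivization.mk F v h ∈ M} := by
  set q : ℝ := (Fintype.card F : ℝ) with hq
  have hq1 : 1 < q := by rw [hq]; exact_mod_cast Fintype.one_lt_card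
  obtain ⟨N, hN⟩ := pow_unbounded_of_one_lt ((β + ε) / ε) hq1
  refine ⟨N, fun n hn M hM => ?_⟩
  have hcone := mul_ncard_le_ncard_cone M
  have hcone' : (q - 1) * M.ncard ≤
      ({v : Fin n → F | ∃ h : v ≠ 0, Projectivization.mk F v h ∈ M}.ncard : ℝ) := by
    rw [hq, ← Nat.cast_one, ← Nat.cast_sub Fintype.card_pos]
    exact_mod_cast hcone
  have hqn : q ^ N ≤ q ^ n := pow_le_pow_right₀ hq1.le hn
  rw [density_eq_ncard_div, le_div_iff₀ (by exact_mod_cast Fintype.card_pos)]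
  simp only [Fintype.card_fun, Fintype.card_fin, Nat.cast_pow, ← hq]
  refine le_trans ?_ hcone'
  rw [mul_div_assoc', div_le_iff₀ (by linarith)] at hM
  rw [div_lt_iff₀ hε] at hN
  nlinarith

/-- A linear map detecting membership in the complement of the standard flat of corank `c`. -/
lemma exists_linearMap_coords (F : Type) [Field F] (r c : ℕ) :
    ∃ φ : (Fin r → F) →ₗ[F] (Fin r → F) × (Fin c → F), Function.Injective φ ∧
      ∀ v, v ∉ stdSubspace F r (r - c) → (φ v).2 ≠ 0 := by
  refine ⟨LinearMap.prod LinearMap.id (LinearMap.pi fun i =>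
    if h : r - c + i < r then LinearMap.proj ⟨r - c + i, h⟩ else 0), fun v w h =>
      congrArg Prod.fst h, fun v hv h0 => hv ?_⟩
  rw [stdSubspace, LinearMap.mem_ker]
  ext ⟨i, hi⟩
  have h : r - c + (i - (r - c)) = i := by omega
  have h1 := congrFun h0 ⟨i - (r - c), by omega⟩
  have h2 : r - c + (i - (r - c)) < r := by omega
  simpa [h2, h] using h1

/-- If `H` has critical exponent `c ≥ 1`, then for every `ε > 0` there is `R` such that
`ex_q(H; n) < (1 - q^(1-c) + ε)(q^n-1)/(q-1)` for all `n > R`. -/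
theorem critical_exponent_upper_bound (F : Type) [Field F] [Fintype F]
    (m : ℕ) (H : Set (Projectivization F (Fin m → F)))
    (c : ℕ) (hc : 1 ≤ c) (hcrit : critExp F m H = c)
    (ε : ℝ) (hε : 0 < ε) :
    ∃ R : ℕ, ∀ n : ℕ, R < n →
      (pgEx F m H n : ℝ) <
        (1 - (Fintype.card F : ℝ) ^ (1 - (c : ℤ)) + ε) *
          (((Fintype.card F : ℝ) ^ n - 1) / ((Fintype.card F : ℝ) - 1)) := by
  have hne : {c | PGContains F m (pgRank F m H) H (pgDel F (pgRank F m H) c)}.Nonempty := by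
    by_contra hne
    rw [critExp, Set.not_nonempty_iff_eq_empty.1 hne, Nat.sInf_empty] at hcrit
    omega
  obtain ⟨f, hf, hfH⟩ : PGContains F m (pgRank F m H) H (pgDel F (pgRank F m H) c) :=
    hcrit ▸ Nat.sInf_mem hne
  obtain ⟨φ, hφ, hφc⟩ := exists_linearMap_coords F (pgRank F m H) c
  set q : ℝ := (Fintype.card F : ℝ) with hq
  have hq1 : 1 < q := by rw [hq]; exact_mod_cast Fintype.one_lt_card
  have hqc : q ^ (1 - (c : ℤ)) * q ^ (c - 1) = 1 := by
    rw [← zpow_natCast, ← zpow_add₀ (by positivity), Nat.cast_sub hc]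
    simp
  have hqc1 : q ^ (1 - (c : ℤ)) ≤ 1 := zpow_le_one_of_nonpos₀ hq1.le (by omega)
  obtain ⟨N₁, hN₁⟩ := exists_linearMap_mem_of_density F (pgRank F m H) c (half_pos hε)
  obtain ⟨N₂, hN₂⟩ := exists_le_density_cone F (β := 1 - q ^ (1 - (c : ℤ)) + ε / 2) (half_pos hε)
  have hcontains : ∀ n, max N₁ N₂ < n → ∀ M : Set (Projectivization F (Fin n → F)),
      ¬ PGContains F m n H M →
        (M.ncard : ℝ) < (1 - q ^ (1 - (c : ℤ)) + ε) * ((q ^ n - 1) / (q - 1)) := by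
    intro n hn M hM
    by_contra! hlarge
    have hd := hN₂ n (by omega) M (le_of_eq_of_le (by ring) hlarge)
    obtain ⟨g, hg, hgM⟩ := hN₁ n (by omega) {v | ∃ h : v ≠ 0, Projectivization.mk F v h ∈ M}
      (fun h => h.1 rfl) (by
      rintro u hu v ⟨hv, hvM⟩
      refine ⟨smul_ne_zero hu hv, ?_⟩
      convert hvM using 1
      exact (Projectivization.mk_eq_mk_iff' F _ _ _ _).2 ⟨u, rfl⟩) (by
      intro i hi
      have hi' : q ^ i ≤ q ^ (c - 1) := pow_le_pow_right₀ hq1.le (by omega)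
      have h1 : 1 ≤ q ^ i := one_le_pow₀ hq1.le
      have h2 : 0 < q ^ (1 - (c : ℤ)) := by positivity
      calc q ^ i * (1 - _) ≤ q ^ i * (q ^ (1 - (c : ℤ)) - ε / 2) :=
            mul_le_mul_of_nonneg_left (by linarith) (by positivity)
        _ = q ^ (1 - (c : ℤ)) * q ^ i - q ^ i * (ε / 2) := by ring
        _ ≤ q ^ (1 - (c : ℤ)) * q ^ (c - 1) - 1 * (ε / 2) := by gcongr
        _ = 1 - ε / 2 := by rw [hqc]; ring)
    refine hM ⟨g ∘ₗ φ ∘ₗ f, hg.comp (hφ.comp hf), fun x hx => ?_⟩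
    have hxf := hfH x hx
    induction x using Projectivization.ind with
    | h v hv =>
      rw [Projectivization.map_mk] at hxf ⊢
      rw [pgDel, Set.mem_ofPred_eq, Projectivization.submodule_mk,
        Submodule.span_singleton_le_iff_mem] at hxf
      exact (hgM _ _ (hφc _ hxf)).2
  refine ⟨max N₁ N₂, fun n hn => ?_⟩
  rcases Set.eq_empty_or_nonempty {k | ∃ M : Set (Projectivization F (Fin n → F)),
    ¬ PGContains F m n H M ∧ M.ncard = k} with h | h
  · rw [pgEx, h, csSup_empty]
    have : 1 < q ^ n := one_lt_pow₀ hq1 (by omega)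
    have h1 : 0 < (q ^ n - 1) / (q - 1) := div_pos (by linarith) (by linarith)
    simpa using mul_pos (by linarith) h1
  · obtain ⟨M, hM, hMn⟩ := Nat.sSup_mem h
      ⟨Nat.card (Projectivization F (Fin n → F)), by
        rintro k ⟨M, -, rfl⟩
        exact Set.ncard_le_card M⟩
    rw [pgEx, ← hMn]
    exact hcontains n hn M hM
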